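/- Let u, s ≥ 1, let G ∈ ℂ^{u×s}, let σ > 0, and let U ∈ ℂ^{s×s} be positive semidefinite. Define J = σ²·I_u + G·G^H, which is Hermitian positive definite and hence invertible, and Q⋆ = J⁻¹·G ∈ ℂ^{u×s}. For Q ∈ ℂ^{u×s} define the error matrix E(Q) = σ²·Q^H·Q + (Q^H·G − I_s)·(Q^H·G − I_s)^H. Then for every Q ∈ ℂ^{u×s}, Re tr(U·E(Q⋆)) ≤ Re tr(U·E(Q)). -/

import Mathlib

open Matrix
open scoped ComplexOrder

/-- The matrix J = σ²·I + G·G^H. -/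
noncomputable def Jmat (u s : ℕ) (σ : ℝ) (G : Matrix (Fin u) (Fin s) ℂ) : Matrix (Fin u) (Fin u) ℂ :=
  ((σ : ℂ) ^ 2) • 1 + G * G.conjTranspose

/-- The decoding MSE matrix E(Q) = σ²·Q^H·Q + (Q^H·G − I)·(Q^H·G − I)^H. -/
noncomputable def errMat (u s : ℕ) (σ : ℝ) (G Q : Matrix (Fin u) (Fin s) ℂ) :
    Matrix (Fin s) (Fin s) ℂ :=
  ((σ : ℂ) ^ 2) • (Q.conjTranspose * Q) +
    (Q.conjTranspose * G - 1) * (Q.conjTranspose * G - 1).conjTranspose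

open scoped MatrixOrder Matrix.Norms.L2Operator in
/-- The trace of a product of two positive semidefinite complex matrices is nonnegative. -/
theorem Matrix.PosSemidef.trace_mul_nonneg {n : Type*} [Fintype n] {A B : Matrix n n ℂ}
    (hA : A.PosSemidef) (hB : B.PosSemidef) : 0 ≤ (A * B).trace := by
  classical
  obtain ⟨C, rfl⟩ := CStarAlgebra.nonneg_iff_eq_star_mul_self.mp hA.nonneg
  rw [Matrix.star_eq_conjTranspose, Matrix.mul_assoc, Matrix.trace_mul_comm]
  exact (hB.mul_mul_conjTranspose_same C).trace_nonneg

theorem posDef_Jmat (u s : ℕ) {σ : ℝ} (hσ : 0 < σ) (G : Matrix (Fin u) (Fin s) ℂ) :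
    (Jmat u s σ G).PosDef := by
  have hσ' : (0 : ℂ) < (σ : ℂ) ^ 2 := by exact_mod_cast pow_pos hσ 2
  exact (Matrix.PosDef.one.smul hσ').add_posSemidef (posSemidef_self_mul_conjTranspose G)

theorem errMat_eq (u s : ℕ) (σ : ℝ) (G Q : Matrix (Fin u) (Fin s) ℂ) :
    errMat u s σ G Q = Qᴴ * Jmat u s σ G * Q - Qᴴ * G - Gᴴ * Q + 1 := by
  simp only [errMat, Jmat, conjTranspose_sub, conjTranspose_mul, conjTranspose_conjTranspose,
    conjTranspose_one, Matrix.mul_add, Matrix.add_mul, Matrix.sub_mul, Matrix.mul_sub,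
    Matrix.mul_one, Matrix.one_mul, Matrix.mul_smul, Matrix.smul_mul, Matrix.mul_assoc]
  abel

/-- Completing the square around a solution `P` of the normal equation `J * P = G`. -/
theorem errMat_eq_add_of_Jmat_mul_eq (u s : ℕ) {σ : ℝ} {G P : Matrix (Fin u) (Fin s) ℂ}
    (hJ : (Jmat u s σ G).IsHermitian) (hP : Jmat u s σ G * P = G)
    (Q : Matrix (Fin u) (Fin s) ℂ) :
    errMat u s σ G Q = errMat u s σ G P + (Q - P)ᴴ * Jmat u s σ G * (Q - P) := by
  have hP' : Pᴴ * Jmat u s σ G = Gᴴ := by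
    rw [← hJ.eq, ← conjTranspose_mul, hP]
  simp only [errMat_eq, conjTranspose_sub, Matrix.sub_mul, Matrix.mul_sub, hP']
  simp only [Matrix.mul_assoc, hP]
  have hPG : Pᴴ * G = Gᴴ * P := by
    rw [← hP', Matrix.mul_assoc, hP]
  rw [hPG]
  abel

/-- J is Hermitian positive definite, and the MMSE receiver Q⋆ = J⁻¹·G
minimizes the weighted MSE Re tr(U·E(Q)) over all Q, for any positive semidefinite
weight U. -/
theorem stmt7 (u s : ℕ) (hu : 1 ≤ u) (hs : 1 ≤ s)
    (G : Matrix (Fin u) (Fin s) ℂ) (σ : ℝ) (hσ : 0 < σ)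
    (U : Matrix (Fin s) (Fin s) ℂ) (hU : U.PosSemidef) :
    (Jmat u s σ G).PosDef ∧
    ∀ Q : Matrix (Fin u) (Fin s) ℂ,
      (Matrix.trace (U * errMat u s σ G ((Jmat u s σ G)⁻¹ * G))).re ≤
      (Matrix.trace (U * errMat u s σ G Q)).re := by
  have hJ := posDef_Jmat u s hσ G
  refine ⟨hJ, fun Q => ?_⟩
  have hP : Jmat u s σ G * ((Jmat u s σ G)⁻¹ * G) = G :=
    Matrix.mul_nonsing_inv_cancel_left _ _ ((Matrix.isUnit_iff_isUnit_det _).mp hJ.isUnit)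
  rw [errMat_eq_add_of_Jmat_mul_eq u s hJ.isHermitian hP Q, Matrix.mul_add, Matrix.trace_add,
    Complex.add_re]
  exact le_add_of_nonneg_right (Complex.le_def.mp
    (hU.trace_mul_nonneg (hJ.posSemidef.conjTranspose_mul_mul_same _))).1
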